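/- arXiv:hep-th/0701250 — 6 statements merged into one kernel-verified Lean document; each statement's English description precedes it below -/
import Mathlib

section
/- Let p ≥ 2 and k be integers with 1 < k < p and p ∣ k·(k−1). Set a = gcd(k, p) and b = gcd(k−1, p). Then a > 1, b > 1, gcd(a, b) = 1, and a·b = p. -/
/-- The key step in Proposition B.2: if `1 < k < p` and `p ∣ k * (k - 1)`, then
`a = gcd k p` and `b = gcd (k - 1) p` satisfy `a > 1`, `b > 1`, `gcd a b = 1`, and
`a * b = p`. -/
theorem stmt_3 (p k : ℕ) (hp : 2 ≤ p) (hk1 : 1 < k) (hkp : k < p)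
    (hdvd : p ∣ k * (k - 1)) :
    1 < Nat.gcd k p ∧ 1 < Nat.gcd (k - 1) p ∧
      Nat.gcd (Nat.gcd k p) (Nat.gcd (k - 1) p) = 1 ∧
      Nat.gcd k p * Nat.gcd (k - 1) p = p := by
  have hc : Nat.Coprime k (k - 1) := by
    obtain ⟨m, rfl⟩ : ∃ m, k = m + 1 := ⟨k - 1, by omega⟩
    simp
  have hmul : Nat.gcd k p * Nat.gcd (k - 1) p = p := by
    rw [Nat.gcd_comm k p, Nat.gcd_comm (k - 1) p, ← hc.gcd_mul p]
    exact Nat.gcd_eq_left hdvd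
  have ha : Nat.gcd k p ≤ k := Nat.gcd_le_left p (by omega)
  have hb : Nat.gcd (k - 1) p ≤ k - 1 := Nat.gcd_le_left p (by omega)
  have ha0 : 0 < Nat.gcd k p := Nat.gcd_pos_of_pos_left p (by omega)
  have hb0 : 0 < Nat.gcd (k - 1) p := Nat.gcd_pos_of_pos_left p (by omega)
  refine ⟨?_, ?_, ?_, hmul⟩
  · by_contra h
    have h1 : Nat.gcd k p = 1 := by omega
    rw [h1, one_mul] at hmul
    omega
  · by_contra h
    have h1 : Nat.gcd (k - 1) p = 1 := by omega
    rw [h1, mul_one] at hmul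
    omega
  · exact Nat.Coprime.of_dvd (Nat.gcd_dvd_left k p) (Nat.gcd_dvd_left (k - 1) p) hc
end

section
/- Let p ≥ 2 be an integer. The map k ↦ gcd(k, p) is a bijection from the set {k : 1 < k < p and p ∣ k·(k−1)} onto the set of unitary proper divisors {a : a ∣ p, 1 < a < p, and gcd(a, p/a) = 1}. -/
theorem key_aux (p k : ℕ) (hk : 1 < k) (h : p ∣ k * (k - 1)) :
    Nat.gcd k p * Nat.gcd (k - 1) p = p ∧ Nat.Coprime (Nat.gcd k p) (Nat.gcd (k - 1) p) := by
  have hc : Nat.Coprime k (k - 1) := by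
    obtain ⟨m, rfl⟩ : ∃ m, k = m + 1 := ⟨k - 1, by omega⟩
    simp
  refine ⟨?_, ?_⟩
  · have h1 := Nat.Coprime.gcd_mul p hc
    rw [Nat.gcd_eq_left h] at h1
    rw [Nat.gcd_comm k, Nat.gcd_comm (k - 1)]
    exact h1.symm
  · exact Nat.Coprime.coprime_dvd_left (Nat.gcd_dvd_left _ _)
      (Nat.Coprime.coprime_dvd_right (Nat.gcd_dvd_left _ _) hc)

/-- The bijection in the proof of Proposition B.2: `k ↦ gcd k p` maps the set of
`k` with `1 < k < p` and `p ∣ k * (k - 1)` bijectively onto the set of unitary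
proper divisors `a ∣ p` with `1 < a < p` and `gcd a (p / a) = 1`. -/
theorem stmt_4 (p : ℕ) (hp : 2 ≤ p) :
    Set.BijOn (fun k => Nat.gcd k p)
      {k : ℕ | 1 < k ∧ k < p ∧ p ∣ k * (k - 1)}
      {a : ℕ | a ∣ p ∧ 1 < a ∧ a < p ∧ Nat.gcd a (p / a) = 1} := by
  refine ⟨?_, ?_, ?_⟩
  · rintro k ⟨h1, h2, h3⟩
    obtain ⟨hm, hc⟩ := key_aux p k h1 h3
    have hpos : 0 < Nat.gcd k p := Nat.gcd_pos_of_pos_left _ (by omega)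
    have hle : Nat.gcd k p ≤ k := Nat.gcd_le_left _ (by omega)
    have hle' : Nat.gcd (k - 1) p ≤ k - 1 := Nat.gcd_le_left _ (by omega)
    refine ⟨Nat.gcd_dvd_right _ _, ?_, by show Nat.gcd k p < p; omega, ?_⟩
    · show 1 < Nat.gcd k p
      by_contra hcon
      have h : Nat.gcd k p = 1 := by omega
      rw [h] at hm
      omega
    · show Nat.gcd (Nat.gcd k p) (p / Nat.gcd k p) = 1
      rw [Nat.div_eq_of_eq_mul_right hpos hm.symm]
      exact hc
  · rintro k ⟨h1, h2, h3⟩ l ⟨h1', h2', h3'⟩ h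
    replace h : Nat.gcd k p = Nat.gcd l p := h
    obtain ⟨hm, hc⟩ := key_aux p k h1 h3
    obtain ⟨hm', hc'⟩ := key_aux p l h1' h3'
    have hpos : 0 < Nat.gcd k p := Nat.gcd_pos_of_pos_left _ (by omega)
    have hb : Nat.gcd (k - 1) p = Nat.gcd (l - 1) p := by
      apply Nat.eq_of_mul_eq_mul_left hpos
      rw [hm, h, hm']
    have ea : k ≡ l [MOD Nat.gcd k p] :=
      ((Nat.modEq_zero_iff_dvd).2 (Nat.gcd_dvd_left k p)).trans
        ((Nat.modEq_zero_iff_dvd).2 (h ▸ Nat.gcd_dvd_left l p)).symm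
    have eb0 : k - 1 ≡ l - 1 [MOD Nat.gcd (k - 1) p] :=
      ((Nat.modEq_zero_iff_dvd).2 (Nat.gcd_dvd_left (k - 1) p)).trans
        ((Nat.modEq_zero_iff_dvd).2 (hb ▸ Nat.gcd_dvd_left (l - 1) p)).symm
    have eb : k ≡ l [MOD Nat.gcd (k - 1) p] := by
      have := eb0.add_right 1
      rwa [Nat.sub_add_cancel (by omega), Nat.sub_add_cancel (by omega)] at this
    have := (Nat.modEq_and_modEq_iff_modEq_mul hc).1 ⟨ea, eb⟩
    rw [hm] at this
    exact Nat.ModEq.eq_of_lt_of_lt this h2 h2'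
  · rintro a ⟨⟨b, rfl⟩, h1, h2, h3⟩
    rw [Nat.mul_div_cancel_left _ (by omega)] at h3
    have hb : 1 < b := by
      by_contra hcon
      have : b ≤ 1 := by omega
      nlinarith
    obtain ⟨k, ka, kb⟩ := Nat.chineseRemainder h3 0 1
    have key : ∃ k, k < a * b ∧ k ≡ 0 [MOD a] ∧ k ≡ 1 [MOD b] :=
      ⟨Nat.chineseRemainder h3 0 1, Nat.chineseRemainder_lt_mul h3 0 1 (by omega) (by omega),
        (Nat.chineseRemainder h3 0 1).2⟩
    clear ka kb k
    obtain ⟨k, hk, ka, kb⟩ := key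
    have da : a ∣ k := (Nat.modEq_zero_iff_dvd).1 ka
    have k0 : k ≠ 0 := by
      rintro rfl
      have := Nat.ModEq.eq_of_lt_of_lt kb (by omega) hb
      omega
    have k1 : 1 < k := lt_of_lt_of_le h1 (Nat.le_of_dvd (by omega) da)
    have db : b ∣ k - 1 := (Nat.modEq_iff_dvd' (by omega)).1 kb.symm
    refine ⟨k, ⟨k1, hk, mul_dvd_mul da db⟩, ?_⟩
    show Nat.gcd k (a * b) = a
    rw [Nat.Coprime.gcd_mul k h3, Nat.gcd_eq_right da, kb.gcd_eq.trans (Nat.gcd_one_left b), mul_one]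
end

section
/- Let p > p' ≥ 2 be coprime integers, and let r', s' be integers with 1 ≤ r' ≤ p'−1 and 1 ≤ s' ≤ p−1. Then the two conditions '1 + |r − r'| = min(r + r' − 1, 2p' − r − r' − 1) for all integers r with 1 ≤ r ≤ p'−1' and '1 + |s − s'| = min(s + s' − 1, 2p − s − s' − 1) for all integers s with 1 ≤ s ≤ p−1' both hold if and only if (r' = 1 or r' = p'−1) and (s' = 1 or s' = p−1). -/
theorem simple_aux (q a : ℤ) (h1 : 1 ≤ a) (h2 : a ≤ q - 1) :
    (∀ r : ℤ, 1 ≤ r → r ≤ q - 1 →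
        1 + |r - a| = min (r + a - 1) (2 * q - r - a - 1)) ↔ (a = 1 ∨ a = q - 1) := by
  constructor
  · intro h
    have := h a h1 h2
    rw [sub_self, abs_zero] at this
    omega
  · intro h r hr1 hr2
    rcases abs_cases (r - a) with ⟨e, _⟩ | ⟨e, _⟩ <;> rw [e] <;> omega

/-- Classification of the simple currents of the minimal model `M(p',p)`: the
fusion-rule conditions in both Kac labels hold if and only if
`(r' = 1 ∨ r' = p' - 1)` and `(s' = 1 ∨ s' = p - 1)`. -/
theorem stmt_8 (p p' r' s' : ℤ) (hp' : 2 ≤ p') (hpp' : p' < p)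
    (hcop : Int.gcd p p' = 1)
    (hr'1 : 1 ≤ r') (hr'2 : r' ≤ p' - 1) (hs'1 : 1 ≤ s') (hs'2 : s' ≤ p - 1) :
    ((∀ r : ℤ, 1 ≤ r → r ≤ p' - 1 →
        1 + |r - r'| = min (r + r' - 1) (2 * p' - r - r' - 1)) ∧
     (∀ s : ℤ, 1 ≤ s → s ≤ p - 1 →
        1 + |s - s'| = min (s + s' - 1) (2 * p - s - s' - 1))) ↔
    ((r' = 1 ∨ r' = p' - 1) ∧ (s' = 1 ∨ s' = p - 1)) := by
  rw [simple_aux p' r' hr'1 hr'2, simple_aux p s' hs'1 hs'2]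
end

section
/- Let p > p' ≥ 3 be coprime integers and let r, s be integers with 1 ≤ r ≤ p'−1 and 1 ≤ s ≤ p−1. Define the rational number θ = 1 − r·s + (p·(r−1) + p'·(s−1))/2. Then θ ≥ 0, and θ = 0 if and only if (r, s) = (1, 1) or (r, s) = (p'−1, p−1). -/
/-- Non-negativity of the u(1)-charge: for coprime `p > p' ≥ 3` and Kac labels
`1 ≤ r ≤ p' - 1`, `1 ≤ s ≤ p - 1`, the charge
`θ = 1 - r s + (p (r - 1) + p' (s - 1)) / 2` satisfies `θ ≥ 0`, with equality
precisely for the identity field `(r,s) = (1,1)` or `(p'-1, p-1)`. -/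
theorem stmt_12 (p p' r s : ℤ) (hp' : 3 ≤ p') (hpp' : p' < p)
    (hcop : Int.gcd p p' = 1)
    (hr1 : 1 ≤ r) (hr2 : r ≤ p' - 1) (hs1 : 1 ≤ s) (hs2 : s ≤ p - 1) :
    0 ≤ 1 - (r : ℚ) * (s : ℚ) + ((p : ℚ) * ((r : ℚ) - 1) + (p' : ℚ) * ((s : ℚ) - 1)) / 2 ∧
    ((1 - (r : ℚ) * (s : ℚ) + ((p : ℚ) * ((r : ℚ) - 1) + (p' : ℚ) * ((s : ℚ) - 1)) / 2 = 0)
      ↔ ((r = 1 ∧ s = 1) ∨ (r = p' - 1 ∧ s = p - 1))) := by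
  have key : 1 - (r : ℚ) * (s : ℚ) + ((p : ℚ) * ((r : ℚ) - 1) + (p' : ℚ) * ((s : ℚ) - 1)) / 2
      = (((r - 1) * (p - 1 - s) + (s - 1) * (p' - 1 - r) : ℤ) : ℚ) / 2 := by
    push_cast
    ring
  have h1 : 0 ≤ (r - 1) * (p - 1 - s) := mul_nonneg (by linarith) (by linarith)
  have h2 : 0 ≤ (s - 1) * (p' - 1 - r) := mul_nonneg (by linarith) (by linarith)
  rw [key]
  constructor
  · have h3 : (0 : ℚ) ≤ (((r - 1) * (p - 1 - s) + (s - 1) * (p' - 1 - r) : ℤ) : ℚ) := by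
      exact_mod_cast add_nonneg h1 h2
    linarith
  · constructor
    · intro h
      have h3 : (((r - 1) * (p - 1 - s) + (s - 1) * (p' - 1 - r) : ℤ) : ℚ) = 0 := by linarith
      have h4 : (r - 1) * (p - 1 - s) + (s - 1) * (p' - 1 - r) = 0 := by exact_mod_cast h3
      have h5 : (r - 1) * (p - 1 - s) = 0 := by linarith
      have h6 : (s - 1) * (p' - 1 - r) = 0 := by linarith
      rcases mul_eq_zero.mp h5 with h7 | h7 <;> rcases mul_eq_zero.mp h6 with h8 | h8 <;> omega
    · rintro (⟨rfl, rfl⟩ | ⟨rfl, rfl⟩) <;> simp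
end

section
/- Let p > p' ≥ 3 be coprime integers with p odd, and let s be an integer with 1 ≤ s ≤ p−1. Then for a rational number r, the equation 1 − r·s + (p·(r−1) + p'·(s−1))/2 = 0 holds if and only if r = 1 + (p'−2)·(s−1)/(2·s − p); moreover this unique solution r never satisfies 1 < r < p'−1. -/
/-- For `p` odd, coprime `p > p' ≥ 3`, and `1 ≤ s ≤ p - 1`: the rational
solution `r` of `θ_{r,s} = 0` is uniquely `r = 1 + (p' - 2)(s - 1)/(2s - p)`,
and this solution never satisfies `1 < r < p' - 1`. -/
theorem stmt_13 (p p' s : ℤ) (hp' : 3 ≤ p') (hpp' : p' < p)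
    (hcop : Int.gcd p p' = 1) (hodd : Odd p) (hs1 : 1 ≤ s) (hs2 : s ≤ p - 1) :
    (∀ r : ℚ,
      (1 - r * (s : ℚ) + ((p : ℚ) * (r - 1) + (p' : ℚ) * ((s : ℚ) - 1)) / 2 = 0) ↔
        r = 1 + ((p' : ℚ) - 2) * ((s : ℚ) - 1) / (2 * (s : ℚ) - (p : ℚ))) ∧
    ¬ (1 < 1 + ((p' : ℚ) - 2) * ((s : ℚ) - 1) / (2 * (s : ℚ) - (p : ℚ)) ∧
        1 + ((p' : ℚ) - 2) * ((s : ℚ) - 1) / (2 * (s : ℚ) - (p : ℚ)) < (p' : ℚ) - 1) := by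
  have hd : (2 * (s : ℚ) - (p : ℚ)) ≠ 0 := by
    obtain ⟨k, hk⟩ := hodd
    have h : 2 * s - p ≠ 0 := by omega
    exact_mod_cast h
  have h1 : (3 : ℚ) ≤ p' := by exact_mod_cast hp'
  have h2 : (1 : ℚ) ≤ s := by exact_mod_cast hs1
  have h3 : (s : ℚ) ≤ p - 1 := by exact_mod_cast hs2
  have hnum : 0 ≤ ((p' : ℚ) - 2) * ((s : ℚ) - 1) :=
    mul_nonneg (by linarith) (by linarith)
  refine ⟨fun r => ?_, ?_⟩
  · rw [← sub_eq_iff_eq_add', eq_div_iff hd]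
    constructor <;> intro h <;> linarith
  · rintro ⟨ha, hb⟩
    rcases lt_or_gt_of_ne hd with hneg | hpos
    · have := div_nonpos_of_nonneg_of_nonpos hnum hneg.le
      linarith
    · have hb' : ((p' : ℚ) - 2) * ((s : ℚ) - 1) / (2 * (s : ℚ) - (p : ℚ)) < (p' : ℚ) - 2 := by
        linarith
      rw [div_lt_iff₀ hpos] at hb'
      have := lt_of_mul_lt_mul_left hb' (by linarith)
      linarith
end

section
/- Let p > p' ≥ 3 be coprime integers. Then there exist integers k and j with 1 < k < p', j ≥ 1, and k·(k−1)·p − p'·(j + k − 1) = 0, if and only if p' is not a prime power. -/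
/-- Vanishing of a factor of the conjectured common denominator
`∏_{k=1}^{p'-1} [k (k-1) p - p' (j + k - 1)]` at some positive integer `j`:
for coprime `p > p' ≥ 3`, there exist `k, j` with `1 < k < p'`, `j ≥ 1`, and
`k (k - 1) p - p' (j + k - 1) = 0` if and only if `p'` is not a prime power. -/
theorem stmt_18 (p p' : ℤ) (hp' : 3 ≤ p') (hpp' : p' < p)
    (hcop : Int.gcd p p' = 1) :
    (∃ k j : ℤ, 1 < k ∧ k < p' ∧ 1 ≤ j ∧ k * (k - 1) * p - p' * (j + k - 1) = 0) ↔
      ¬ ∃ (q n : ℕ), q.Prime ∧ 1 ≤ n ∧ p' = (q : ℤ) ^ n := by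
  constructor
  · rintro ⟨k, j, hk1, hk2, hj, h⟩ ⟨q, n, hq, hn, rfl⟩
    have hc : IsCoprime ((q : ℤ) ^ n) p := (Int.isCoprime_iff_gcd_eq_one.mpr hcop).symm
    have hd : (q : ℤ) ^ n ∣ k * (k - 1) :=
      hc.dvd_of_dvd_mul_right ⟨j + k - 1, by linarith⟩
    have hqp : Prime (q : ℤ) := Nat.prime_iff_prime_int.mp hq
    by_cases hqk : (q : ℤ) ∣ k
    · have h1 : ¬ (q : ℤ) ∣ k - 1 := fun h1 => by
        have h2 := dvd_sub hqk h1
        rw [sub_sub_cancel] at h2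
        exact hqp.not_unit (isUnit_of_dvd_one h2)
      have h2 : IsCoprime ((q : ℤ) ^ n) (k - 1) :=
        ((Prime.coprime_iff_not_dvd hqp).mpr h1).pow_left
      have := Int.le_of_dvd (by omega) (h2.dvd_of_dvd_mul_right hd)
      omega
    · have h2 : IsCoprime ((q : ℤ) ^ n) k :=
        ((Prime.coprime_iff_not_dvd hqp).mpr hqk).pow_left
      have := Int.le_of_dvd (by omega) (h2.dvd_of_dvd_mul_left hd)
      omega
  · intro hnp
    lift p' to ℕ using by omega
    have hne : p' ≠ 1 := by omega
    have hq := Nat.minFac_prime hne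
    have hqd := Nat.minFac_dvd p'
    obtain ⟨e, b, hb, hpe⟩ :=
      Nat.exists_eq_pow_mul_and_not_dvd (n := p') (by omega) p'.minFac hq.ne_one
    generalize p'.minFac = q at hq hb hpe hqd
    have he : e ≠ 0 := by
      rintro rfl
      apply hb
      simpa [hpe] using hqd
    have hb1 : b ≠ 1 := by
      rintro rfl
      exact hnp ⟨q, e, hq, by omega, by rw [hpe]; push_cast; ring⟩
    have hb0 : b ≠ 0 := by
      rintro rfl
      simp at hb
    have hab : Nat.Coprime (q ^ e) b :=
      Nat.Coprime.pow_left e ((Nat.Prime.coprime_iff_not_dvd hq).mpr hb)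
    have ha0 : q ^ e ≠ 0 := pow_ne_zero e hq.ne_zero
    have ha1 : q ^ e ≠ 1 := (Nat.one_lt_pow he hq.one_lt).ne'
    generalize q ^ e = a at hab ha0 ha1 hpe
    have hklt : (Nat.chineseRemainder hab 0 1 : ℕ) < a * b :=
      Nat.chineseRemainder_lt_mul hab 0 1 ha0 hb0
    have hka := (Nat.chineseRemainder hab 0 1).2.1
    have hkb := (Nat.chineseRemainder hab 0 1).2.2
    generalize (Nat.chineseRemainder hab 0 1 : ℕ) = k at hklt hka hkb
    have hk0 : k ≠ 0 := by
      rintro rfl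
      exact hb1 (Nat.dvd_one.mp ((Nat.modEq_zero_iff_dvd).mp hkb.symm))
    have hk1 : k ≠ 1 := by
      rintro rfl
      exact ha1 (Nat.dvd_one.mp ((Nat.modEq_zero_iff_dvd).mp hka))
    have hak : (a : ℤ) ∣ k := Int.natCast_dvd_natCast.mpr ((Nat.modEq_zero_iff_dvd).mp hka)
    have hbk : (b : ℤ) ∣ (k : ℤ) - 1 := by
      have := (Nat.modEq_iff_dvd).mp hkb.symm
      simpa using this
    obtain ⟨c, hc⟩ := mul_dvd_mul hak hbk
    have hkp : (k : ℤ) < p' := by rw [hpe]; exact_mod_cast hklt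
    have hpc : (p' : ℤ) = a * b := by rw [hpe]; push_cast; ring
    rw [← hpc] at hc
    have hk2 : (1 : ℤ) < k := by omega
    refine ⟨k, c * p - k + 1, hk2, hkp, ?_, by rw [hc]; ring⟩
    have h1 : 0 < (p' : ℤ) * (c * p - (k - 1)) := by
      have : (p' : ℤ) * (c * p - (k - 1)) = (k - 1) * (k * p - p') := by
        linear_combination (-p) * hc
      rw [this]
      apply mul_pos <;> nlinarith
    have h2 := (mul_pos_iff_of_pos_left (by omega : (0 : ℤ) < p')).mp h1
    linarith
end
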